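/- arXiv:1809.07244 — 5 statements merged into one kernel-verified Lean document; each statement's English description precedes it below -/
import Mathlib

section
/- The infimum of the probabilities assigned to the set of primes by members of PR is 0: sInf {μ(ℕ_p) : μ ∈ PR} = 0, where ℕ_p ⊆ ℤ is the set of (positive) prime numbers regarded as integers. -/
/-- A probability charge on ℤ: normalized, nonnegative, finitely additive. -/
def IsProbCharge (μ : Set ℤ → ℝ) : Prop :=
  μ Set.univ = 1 ∧ (∀ A : Set ℤ, 0 ≤ μ A) ∧
    ∀ A B : Set ℤ, Disjoint A B → μ (A ∪ B) = μ A + μ B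

/-- The class of charges giving each residue class mod a prime `p` probability `1/p`. -/
def PR : Set (Set ℤ → ℝ) :=
  {μ | IsProbCharge μ ∧
    ∀ p : ℕ, p.Prime → ∀ j : ℤ, μ {z : ℤ | z ≡ j [ZMOD (p : ℤ)]} = 1 / (p : ℝ)}

/-- The set of (positive) primes, regarded as integers. -/
def IntPrimes : Set ℤ := {z : ℤ | 0 < z ∧ Prime z}

open Classical in
/-- The proportion of elements of `A` among the integers `0, -1, …, -n`. -/
noncomputable def negDensity (A : Set ℤ) (n : ℕ) : ℝ :=
  (Nat.count (fun k : ℕ => -(k : ℤ) ∈ A) (n + 1) : ℝ) / ((n + 1 : ℕ) : ℝ)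

theorem negDensity_mem_Icc (A : Set ℤ) (n : ℕ) : negDensity A n ∈ Set.Icc (0 : ℝ) 1 := by
  classical
  refine ⟨by unfold negDensity; positivity, div_le_one_of_le₀ ?_ (by positivity)⟩
  exact_mod_cast Nat.count_le _

theorem negDensity_union {A B : Set ℤ} (h : Disjoint A B) (n : ℕ) :
    negDensity (A ∪ B) n = negDensity A n + negDensity B n := by
  classical
  unfold negDensity
  rw [← add_div, ← Nat.cast_add]
  congr 2
  simp only [Nat.count_eq_card_filter_range]
  rw [← Finset.card_union_of_disjoint, ← Finset.filter_or]
  · simp only [Set.mem_union]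
  · rw [Finset.disjoint_filter]
    exact fun k _ hA hB => Set.disjoint_left.1 h hA hB

theorem tendsto_negDensity_modEq {p : ℕ} (hp : 0 < p) (j : ℤ) :
    Filter.Tendsto (negDensity {z : ℤ | z ≡ j [ZMOD (p : ℤ)]}) Filter.atTop
      (nhds (1 / (p : ℝ))) := by
  classical
  have hp' : (0 : ℝ) < p := by exact_mod_cast hp
  obtain ⟨v, hv⟩ : ∃ v : ℕ, (v : ℤ) = (-j) % p :=
    ⟨((-j) % p).toNat, Int.toNat_of_nonneg (Int.emod_nonneg _ (by omega))⟩
  have key (k : ℕ) : -(k : ℤ) ≡ j [ZMOD (p : ℤ)] ↔ k ≡ v [MOD p] := by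
    rw [← Int.natCast_modEq_iff, hv]
    have h1 : (-j) % (p : ℤ) ≡ -j [ZMOD (p : ℤ)] := Int.mod_modEq _ _
    constructor
    · intro h
      have h2 := h.neg
      rw [neg_neg] at h2
      exact h2.trans h1.symm
    · intro h
      simpa using (h.trans h1).neg
  have bound (n : ℕ) : |negDensity {z : ℤ | z ≡ j [ZMOD (p : ℤ)]} n - 1 / (p : ℝ)|
      ≤ 1 / ((n : ℝ) + 1) := by
    have hn : (0 : ℝ) < (n : ℝ) + 1 := by positivity
    unfold negDensity
    simp only [Set.mem_ofPred_eq, key]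
    rw [Nat.count_modEq_card (n + 1) hp v]
    have h2 : (p : ℝ) * ((n + 1) / p : ℕ) + ((n + 1) % p : ℕ) = (n : ℝ) + 1 := by
      exact_mod_cast Nat.div_add_mod (n + 1) p
    have h3 : (((n + 1) % p : ℕ) : ℝ) ≤ p := by exact_mod_cast (Nat.mod_lt (n + 1) hp).le
    have h4 : (0 : ℝ) ≤ (((n + 1) % p : ℕ) : ℝ) := by positivity
    generalize (((n + 1) % p : ℕ) : ℝ) = r at h2 h3 h4
    push_cast
    generalize (((n + 1) / p : ℕ) : ℝ) = q at h2
    obtain ⟨e, he, he0, he1⟩ : ∃ e : ℝ,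
        e = (if v % p < (n + 1) % p then (1 : ℝ) else 0) ∧ 0 ≤ e ∧ e ≤ 1 := by
      refine ⟨_, rfl, ?_, ?_⟩ <;> split_ifs <;> norm_num
    rw [← he]
    have h5 : (q + e) / ((n : ℝ) + 1) - 1 / p = (e - r / p) / ((n : ℝ) + 1) := by
      field_simp
      linarith
    have h6 : r / p ≤ 1 := div_le_one_of_le₀ h3 hp'.le
    have h7 : 0 ≤ r / p := by positivity
    rw [h5, abs_div, abs_of_pos hn]
    gcongr
    rw [abs_le]
    constructor <;> linarith
  rw [tendsto_iff_dist_tendsto_zero]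
  exact squeeze_zero (fun _ => dist_nonneg) bound tendsto_one_div_add_atTop_nhds_zero_nat

/-- There is a charge in `PR` extending the density along the negative integers, and so
vanishing on the primes. -/
theorem exists_mem_PR_intPrimes_eq_zero : ∃ μ ∈ PR, μ IntPrimes = 0 := by
  classical
  have hex (A : Set ℤ) : ∃ x ∈ Set.Icc (0 : ℝ) 1,
      Filter.Tendsto (negDensity A) (Filter.hyperfilter ℕ : Filter ℕ) (nhds x) :=
    isCompact_Icc.ultrafilter_le_nhds ((Filter.hyperfilter ℕ).map (negDensity A))
      (Filter.le_principal_iff.2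
        (Filter.mem_map.2 (Filter.Eventually.of_forall (negDensity_mem_Icc A))))
  choose μ hμ hlim using hex
  have hle : (Filter.hyperfilter ℕ : Filter ℕ) ≤ Filter.atTop := by
    rw [← Nat.cofinite_eq_atTop]
    exact Filter.hyperfilter_le_cofinite
  refine ⟨μ, ⟨⟨?_, fun A => (hμ A).1, fun A B h => ?_⟩, fun p hp j => ?_⟩, ?_⟩
  · refine tendsto_nhds_unique (hlim Set.univ) (tendsto_const_nhds.congr fun n => ?_)
    have hn : ((n + 1 : ℕ) : ℝ) ≠ 0 := by positivity
    simp [negDensity, Nat.count_true, -Nat.cast_add, hn]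
  · refine tendsto_nhds_unique (hlim (A ∪ B)) (((hlim A).add (hlim B)).congr fun n => ?_)
    exact (negDensity_union h n).symm
  · exact tendsto_nhds_unique (hlim _) ((tendsto_negDensity_modEq hp.pos j).mono_left hle)
  · refine tendsto_nhds_unique (hlim IntPrimes) (tendsto_const_nhds.congr fun n => ?_)
    have h (k : ℕ) : ¬ -(k : ℤ) ∈ IntPrimes := fun h => by
      have := h.1
      omega
    simp [negDensity, h]

theorem stmt1 : sInf {x : ℝ | ∃ μ ∈ PR, μ IntPrimes = x} = 0 := by
  refine IsLeast.csInf_eq ⟨exists_mem_PR_intPrimes_eq_zero, ?_⟩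
  rintro x ⟨μ, hμ, rfl⟩
  exact hμ.1.2.1 _
end

section
/- The set of values that probability charges in PR can assign to the set of primes is exactly the closed interval [0, 1/2]: {μ(ℕ_p) : μ ∈ PR} = [0, 1/2]. In particular, for every real w, there exists μ ∈ PR with μ(ℕ_p) = w if and only if 0 ≤ w ≤ 1/2. -/
open Filter Topology

lemma IsProbCharge.mono {μ : Set ℤ → ℝ} (h : IsProbCharge μ) {A B : Set ℤ} (hAB : A ⊆ B) :
    μ A ≤ μ B := by
  have h1 := h.2.2 A (B \ A) Set.disjoint_sdiff_right
  rw [Set.union_sdiff_cancel hAB] at h1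
  linarith [h.2.1 (B \ A)]

lemma singleton_eq_zero_of_mem_PR {μ : Set ℤ → ℝ} (h : μ ∈ PR) (a : ℤ) : μ {a} = 0 := by
  refine le_antisymm (le_of_forall_pos_le_add fun ε hε => ?_) (h.1.2.1 _)
  obtain ⟨n, hn⟩ := exists_nat_gt (1 / ε)
  obtain ⟨p, hnp, hp⟩ := Nat.exists_infinite_primes n
  have hle : μ {a} ≤ 1 / (p : ℝ) := by
    rw [← h.2 p hp a]
    exact h.1.mono (by simp [Int.ModEq.refl])
  have hlt : 1 / ε < (p : ℝ) := hn.trans_le (by exact_mod_cast hnp)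
  have := (one_div_lt hε (by exact_mod_cast hp.pos)).1 hlt
  linarith

lemma primes_le_half_of_mem_PR {μ : Set ℤ → ℝ} (h : μ ∈ PR) : μ IntPrimes ≤ 1 / 2 := by
  have hsub : IntPrimes ⊆ {2} ∪ ({z : ℤ | z ≡ 1 [ZMOD ((2 : ℕ) : ℤ)]} \ {2}) := by
    rintro z ⟨hz, hp⟩
    obtain ⟨n, rfl⟩ := Int.eq_ofNat_of_zero_le hz.le
    rcases (Nat.prime_iff_prime_int.2 hp).eq_two_or_odd with h2 | h2
    · left; simp [h2]
    · right
      simp only [Set.mem_sdiff, Set.mem_ofPred_eq, Set.mem_singleton_iff, Int.ModEq]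
      omega
  have h1 := h.1.mono hsub
  rw [h.1.2.2 _ _ Set.disjoint_sdiff_right, singleton_eq_zero_of_mem_PR h] at h1
  have h2 := h.2 2 Nat.prime_two 1
  have h3 := h.1.mono (Set.sdiff_subset (s := {z : ℤ | z ≡ 1 [ZMOD ((2 : ℕ) : ℤ)]}) (t := {2}))
  push_cast at h1 h2 h3
  linarith

open Classical in
/-- The empirical distribution of the finite sequence `z 0, …, z (M - 1)`. -/
noncomputable def empirical (M : ℕ) (z : ℕ → ℤ) (A : Set ℤ) : ℝ :=
  (((Finset.range M).filter fun k => z k ∈ A).card : ℝ) / M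

lemma empirical_eq_card_div {M : ℕ} {z : ℕ → ℤ} {A : Set ℤ} {s : Finset ℕ}
    (hs : ∀ k, k ∈ s ↔ k < M ∧ z k ∈ A) : empirical M z A = (s.card : ℝ) / M := by
  classical
  unfold empirical
  congr 3
  ext k
  simp [hs]

lemma empirical_nonneg (M : ℕ) (z : ℕ → ℤ) (A : Set ℤ) : 0 ≤ empirical M z A := by
  unfold empirical; positivity

lemma empirical_le_one (M : ℕ) (z : ℕ → ℤ) (A : Set ℤ) : empirical M z A ≤ 1 := by
  classical
  refine div_le_one_of_le₀ ?_ (by positivity)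
  exact_mod_cast (Finset.card_filter_le _ _).trans_eq (Finset.card_range M)

lemma empirical_univ {M : ℕ} (hM : 0 < M) (z : ℕ → ℤ) : empirical M z Set.univ = 1 := by
  have : (M : ℝ) ≠ 0 := by positivity
  simp [empirical, this]

lemma empirical_union (M : ℕ) (z : ℕ → ℤ) {A B : Set ℤ} (hAB : Disjoint A B) :
    empirical M z (A ∪ B) = empirical M z A + empirical M z B := by
  classical
  unfold empirical
  rw [← add_div, ← Nat.cast_add, ← Finset.card_union_of_disjoint]
  · rw [← Finset.filter_or]
    simp only [Set.mem_union]
  · exact Finset.disjoint_filter.2 fun k _ hA hB => Set.disjoint_left.1 hAB hA hB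

lemma exists_probCharge_of_empirical {M : ℕ → ℕ} (hM : ∀ N, 0 < M N) (z : ℕ → ℕ → ℤ) :
    ∃ μ, IsProbCharge μ ∧ ∀ A x, Tendsto (fun N => empirical (M N) (z N) A) atTop (𝓝 x) →
      μ A = x := by
  have hlim : ∀ A, ∃ x : ℝ,
      Tendsto (fun N => empirical (M N) (z N) A) (hyperfilter ℕ) (𝓝 x) := by
    intro A
    obtain ⟨x, -, hx⟩ := (isCompact_Icc (a := (0 : ℝ)) (b := 1)).ultrafilter_le_nhds
      ((hyperfilter ℕ).map fun N => empirical (M N) (z N) A)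
      (by
        rw [le_principal_iff]
        refine Ultrafilter.mem_coe.2 (Ultrafilter.mem_map.2 (Eventually.of_forall fun N => ?_))
        exact Set.mem_Icc.2 ⟨empirical_nonneg _ _ _, empirical_le_one _ _ _⟩)
    exact ⟨x, hx⟩
  choose μ hμ using hlim
  refine ⟨μ, ⟨?_, fun A => ?_, fun A B hAB => ?_⟩, fun A x hx => ?_⟩
  · refine tendsto_nhds_unique (hμ _) ?_
    simp only [empirical_univ (hM _)]
    exact tendsto_const_nhds
  · exact ge_of_tendsto' (hμ A) fun N => empirical_nonneg _ _ _
  · refine tendsto_nhds_unique (hμ _) ?_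
    simp only [empirical_union _ _ hAB]
    exact (hμ A).add (hμ B)
  · exact tendsto_nhds_unique (hμ A) (hx.mono_left Nat.hyperfilter_le_atTop)

lemma exists_nonpos_modEq (N : ℕ) (a : ℕ → ℕ) :
    ∃ z : ℤ, z ≤ 0 ∧ ∀ p ≤ N, p.Prime → z ≡ a p [ZMOD (p : ℤ)] := by
  have hs : ∀ p ∈ (Finset.range (N + 1)).filter Nat.Prime, p ≠ 0 := fun p hp =>
    (Finset.mem_filter.1 hp).2.ne_zero
  obtain ⟨x, hx⟩ := Nat.chineseRemainderOfFinset a id _ hs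
    (fun p hp q hq hpq => (Nat.coprime_primes (Finset.mem_filter.1 hp).2
      (Finset.mem_filter.1 hq).2).2 hpq)
  refine ⟨x - (N.factorial : ℤ) * x, ?_, fun p hpN hp => ?_⟩
  · have : (1 : ℤ) ≤ N.factorial := by exact_mod_cast N.factorial_pos
    nlinarith [Int.natCast_nonneg x]
  · have h1 : (x : ℤ) ≡ a p [ZMOD (p : ℤ)] :=
      Int.natCast_modEq_iff.2 (hx p (by simp [hp]; omega))
    have h2 : (p : ℤ) ∣ (N.factorial : ℤ) * x :=
      Dvd.dvd.mul_right (by exact_mod_cast Nat.dvd_factorial hp.pos hpN) _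
    simpa using h1.sub (Int.modEq_zero_iff_dvd.2 h2)

lemma exists_mem_intPrimes_modEq (N : ℕ) (a : ℕ → ℕ)
    (ha : ∀ p ≤ N, p.Prime → ¬ p ∣ a p) :
    ∃ z ∈ IntPrimes, ∀ p ≤ N, p.Prime → z ≡ a p [ZMOD (p : ℤ)] := by
  obtain ⟨x, -, hx⟩ := exists_nonpos_modEq N a
  have hcop : IsCoprime x (N.factorial : ℤ) := by
    rw [Int.isCoprime_iff_gcd_eq_one]
    by_contra hne
    obtain ⟨p, hp, hpd⟩ := Nat.exists_prime_and_dvd hne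
    have hpx : (p : ℤ) ∣ x := (Int.natCast_dvd_natCast.2 hpd).trans (Int.gcd_dvd_left ..)
    have hpN : (p : ℤ) ∣ (N.factorial : ℤ) :=
      (Int.natCast_dvd_natCast.2 hpd).trans (Int.gcd_dvd_right ..)
    have hle : p ≤ N := hp.dvd_factorial.1 (by exact_mod_cast hpN)
    have h3 := (hx p hle hp).symm.trans (Int.modEq_zero_iff_dvd.2 hpx)
    exact ha p hle hp (by exact_mod_cast Int.modEq_zero_iff_dvd.1 h3)
  have : NeZero N.factorial := ⟨N.factorial_ne_zero⟩
  have hunit : IsUnit (x : ZMod N.factorial) := by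
    obtain ⟨u, v, huv⟩ := hcop
    refine IsUnit.of_mul_eq_one (u : ZMod N.factorial) ?_
    have := congrArg (Int.cast : ℤ → ZMod N.factorial) huv
    push_cast at this
    simpa [mul_comm] using this
  obtain ⟨q, -, hq, hqx⟩ := Nat.forall_exists_prime_gt_and_eq_mod hunit 0
  have hqx' : (q : ℤ) ≡ x [ZMOD (N.factorial : ℤ)] := by
    rw [← ZMod.intCast_eq_intCast_iff]
    exact_mod_cast hqx
  refine ⟨q, ⟨by exact_mod_cast hq.pos, Nat.prime_iff_prime_int.1 hq⟩, fun p hpN hp => ?_⟩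
  exact (hqx'.of_dvd (by exact_mod_cast Nat.dvd_factorial hp.pos hpN)).trans (hx p hpN hp)

/-- Integers whose residue mod `p` is `p - 1 - ⌊p k / M⌋`, which are prime exactly for `k < T`. -/
lemma exists_equidistributed_sequence (N M T : ℕ) (hT : ∀ k < T, 2 * k < M) :
    ∃ z : ℕ → ℤ, (∀ k, z k ∈ IntPrimes ↔ k < T) ∧
      ∀ k, ∀ p ≤ N, p.Prime → z k ≡ (p - 1 - p * k / M : ℕ) [ZMOD (p : ℤ)] := by
  have key : ∀ k, ∃ z : ℤ, (z ∈ IntPrimes ↔ k < T) ∧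
      ∀ p ≤ N, p.Prime → z ≡ (p - 1 - p * k / M : ℕ) [ZMOD (p : ℤ)] := by
    intro k
    by_cases hk : k < T
    · obtain ⟨z, hz, h⟩ := exists_mem_intPrimes_modEq N (fun p => p - 1 - p * k / M) (by
        intro p _ hp
        have hp2 := hp.two_le
        have hlt : p * k / M < p - 1 := by
          have hkM := hT k hk
          obtain ⟨q, rfl⟩ : ∃ q, p = q + 2 := ⟨p - 2, by omega⟩
          rw [Nat.div_lt_iff_lt_mul (by omega)]
          have : q + 2 - 1 = q + 1 := by omega
          rw [this]
          nlinarith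
        generalize p * k / M = c at hlt ⊢
        exact Nat.not_dvd_of_pos_of_lt (by omega) (by omega))
      exact ⟨z, by simp [hz, hk], h⟩
    · obtain ⟨z, hz, h⟩ := exists_nonpos_modEq N (fun p => p - 1 - p * k / M)
      refine ⟨z, ?_, h⟩
      simp only [hk, iff_false]
      exact fun h => absurd h.1 (by omega)
  choose z hz using key
  exact ⟨z, fun k => (hz k).1, fun k => (hz k).2⟩

lemma empirical_residue {M p : ℕ} (hM : 0 < M) (hp : 0 < p) (hpM : p ∣ M) {z : ℕ → ℤ}
    (hz : ∀ k, z k ≡ (p - 1 - p * k / M : ℕ) [ZMOD (p : ℤ)]) (j : ℤ) :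
    empirical M z {x : ℤ | x ≡ j [ZMOD (p : ℤ)]} = 1 / (p : ℝ) := by
  obtain ⟨m, rfl⟩ := hpM
  have hm : 0 < m := Nat.pos_of_mul_pos_left hM
  have hp' : (0 : ℤ) < p := by exact_mod_cast hp
  obtain ⟨r, hr⟩ := Int.eq_ofNat_of_zero_le (Int.emod_nonneg j hp'.ne')
  have hrp : r < p := by
    have := Int.emod_lt_of_pos j hp'
    omega
  have hset : ∀ k, k ∈ Finset.Ico ((p - 1 - r) * m) ((p - 1 - r + 1) * m) ↔
      k < p * m ∧ z k ∈ {x : ℤ | x ≡ j [ZMOD (p : ℤ)]} := by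
    intro k
    have hkey : k < p * m → (z k ≡ j [ZMOD (p : ℤ)] ↔ k / m = p - 1 - r) := by
      intro hk
      have hkp : k / m < p := (Nat.div_lt_iff_lt_mul hm).2 hk
      have h1 := hz k
      rw [Nat.mul_div_mul_left _ _ hp] at h1
      generalize k / m = c at hkp h1 ⊢
      unfold Int.ModEq at h1 ⊢
      rw [h1, hr, ← Int.natCast_mod, Nat.mod_eq_of_lt (by omega)]
      omega
    have hdiv : k / m = p - 1 - r ↔ (p - 1 - r) * m ≤ k ∧ k < (p - 1 - r + 1) * m := by
      rw [← Nat.le_div_iff_mul_le hm, ← Nat.div_lt_iff_lt_mul hm]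
      omega
    have hle : (p - 1 - r + 1) * m ≤ p * m := Nat.mul_le_mul_right _ (by omega)
    rw [Set.mem_ofPred_eq, Finset.mem_Ico]
    constructor
    · intro h
      have hk := h.2.trans_le hle
      exact ⟨hk, (hkey hk).2 (hdiv.2 h)⟩
    · rintro ⟨hk, h⟩
      exact hdiv.1 ((hkey hk).1 h)
  have hcard : (Finset.Ico ((p - 1 - r) * m) ((p - 1 - r + 1) * m)).card = m := by
    rw [Nat.card_Ico, add_mul, one_mul, Nat.add_sub_cancel_left]
  rw [empirical_eq_card_div hset, hcard]
  have : (m : ℝ) ≠ 0 := by positivity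
  have : (p : ℝ) ≠ 0 := by positivity
  push_cast
  field_simp

lemma empirical_intPrimes {M T : ℕ} (hTM : T ≤ M) {z : ℕ → ℤ}
    (hz : ∀ k, z k ∈ IntPrimes ↔ k < T) : empirical M z IntPrimes = (T : ℝ) / M := by
  have hs : ∀ k, k ∈ Finset.range T ↔ k < M ∧ z k ∈ IntPrimes := fun k => by
    rw [hz, Finset.mem_range]
    omega
  rw [empirical_eq_card_div hs, Finset.card_range]

lemma exists_mem_PR_primes_eq {w : ℝ} (hw : 0 ≤ w) (hw' : w ≤ 1 / 2) :
    ∃ μ ∈ PR, μ IntPrimes = w := by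
  have hT : ∀ N : ℕ, ∀ k < ⌈w * (N.factorial : ℝ)⌉₊, 2 * k < N.factorial := by
    intro N k hk
    have h1 := Nat.lt_ceil.1 hk
    have h2 : (2 * k : ℝ) < N.factorial := by
      nlinarith [(Nat.cast_nonneg N.factorial : (0 : ℝ) ≤ N.factorial)]
    exact_mod_cast h2
  choose z hz hmod using fun N : ℕ =>
    exists_equidistributed_sequence N N.factorial ⌈w * (N.factorial : ℝ)⌉₊ (hT N)
  obtain ⟨μ, hμ, hlim⟩ := exists_probCharge_of_empirical Nat.factorial_pos z
  refine ⟨μ, ⟨hμ, fun p hp j => hlim _ _ ?_⟩, hlim _ _ ?_⟩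
  · refine tendsto_const_nhds.congr' ?_
    filter_upwards [eventually_ge_atTop p] with N hN
    exact (empirical_residue N.factorial_pos hp.pos (Nat.dvd_factorial hp.pos hN)
      (fun k => hmod N k p hN hp) j).symm
  · have hTM : ∀ N : ℕ, ⌈w * (N.factorial : ℝ)⌉₊ ≤ N.factorial := fun N =>
      Nat.ceil_le.2 (mul_le_of_le_one_left (by positivity) (by linarith))
    simp only [fun N => empirical_intPrimes (hTM N) (hz N)]
    exact (tendsto_nat_ceil_mul_div_atTop hw).comp
      (tendsto_natCast_atTop_atTop.comp factorial_tendsto_atTop)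

theorem stmt2 : {x : ℝ | ∃ μ ∈ PR, μ IntPrimes = x} = Set.Icc 0 (1 / 2) := by
  ext w
  constructor
  · rintro ⟨μ, hμ, rfl⟩
    exact ⟨hμ.1.2.1 _, primes_le_half_of_mem_PR hμ⟩
  · rintro ⟨h0, h1⟩
    exact exists_mem_PR_primes_eq h0 h1
end

section
/- PR strictly contains the class R of charges uniform on all residue classes: there exists a probability charge μ ∈ PR and a positive integer m and an integer r such that μ({z ∈ ℤ : z ≡ r (mod m)}) ≠ 1/m. Concretely, there exists μ ∈ PR with μ({z ∈ ℤ : z ≡ 0 (mod 4)}) = 0. -/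
open Filter Topology in
/-- The pointwise limit of probability charges along an ultrafilter is a probability charge. -/
lemma exists_isProbCharge_tendsto {ι : Type*} (u : Ultrafilter ι) (ν : ι → Set ℤ → ℝ)
    (hν : ∀ i, IsProbCharge (ν i)) :
    ∃ μ, IsProbCharge μ ∧ ∀ A, Tendsto (fun i => ν i A) u (𝓝 (μ A)) := by
  have bounded : ∀ i A, ν i A ∈ Set.Icc (0 : ℝ) 1 := by
    intro i A
    obtain ⟨h1, h0, hadd⟩ := hν i
    have h := hadd A Aᶜ disjoint_compl_right
    rw [Set.union_compl_self, h1] at h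
    exact ⟨h0 A, by linarith [h0 Aᶜ]⟩
  have conv : ∀ A, ∃ x, Tendsto (fun i => ν i A) u (𝓝 x) := by
    intro A
    obtain ⟨x, -, hx⟩ := (isCompact_Icc (a := (0 : ℝ)) (b := 1)).ultrafilter_le_nhds
      (u.map fun i => ν i A)
      (le_principal_iff.2 (mem_map.2 (univ_mem' fun i => bounded i A)))
    exact ⟨x, hx⟩
  choose μ hμ using conv
  refine ⟨μ, ⟨?_, fun A => ?_, fun A B hAB => ?_⟩, hμ⟩
  · exact tendsto_nhds_unique (hμ Set.univ)
      (tendsto_const_nhds.congr fun i => (hν i).1.symm)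
  · exact ge_of_tendsto' (hμ A) fun i => (hν i).2.1 A
  · exact tendsto_nhds_unique (hμ (A ∪ B))
      (((hμ A).add (hμ B)).congr fun i => ((hν i).2.2 A B hAB).symm)

open Classical in
/-- The distribution of `f` under the uniform distribution on `s`. -/
noncomputable def uniformCharge (s : Finset ℤ) (f : ℤ → ℤ) (A : Set ℤ) : ℝ :=
  (s.filter fun z => f z ∈ A).card / s.card

lemma uniformCharge_eq (s : Finset ℤ) (f : ℤ → ℤ) (A : Set ℤ) [DecidablePred fun z => f z ∈ A] :
    uniformCharge s f A = (s.filter fun z => f z ∈ A).card / s.card := by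
  unfold uniformCharge
  congr!

lemma isProbCharge_uniformCharge {s : Finset ℤ} (hs : s.Nonempty) (f : ℤ → ℤ) :
    IsProbCharge (uniformCharge s f) := by
  classical
  refine ⟨?_, fun A => ?_, fun A B hAB => ?_⟩
  · have : (s.card : ℝ) ≠ 0 := by exact_mod_cast hs.card_pos.ne'
    simp [uniformCharge, this]
  · unfold uniformCharge
    positivity
  · simp only [uniformCharge_eq, Set.mem_union]
    rw [← add_div, ← Nat.cast_add, ← Finset.card_union_of_disjoint, ← Finset.filter_or]
    exact Finset.disjoint_filter.2 fun z _ hA hB => Set.disjoint_left.1 hAB hA hB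

lemma uniformCharge_modEq {N p : ℕ} (hN : 0 < N) (hp : 0 < p) (hpN : p ∣ N) {f : ℤ → ℤ}
    (hf : ∀ z, f z ≡ z [ZMOD p]) (j : ℤ) :
    uniformCharge (Finset.Ico 0 (N : ℤ)) f {z | z ≡ j [ZMOD p]} = 1 / p := by
  classical
  obtain ⟨k, rfl⟩ := hpN
  have hk : 0 < k := Nat.pos_of_mul_pos_left hN
  have hset : ((Finset.Ico 0 ((p * k : ℕ) : ℤ)).filter fun z => f z ∈ {z | z ≡ j [ZMOD p]}) =
      (Finset.Ico 0 ((p * k : ℕ) : ℤ)).filter fun z => z ≡ j [ZMOD p] :=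
    Finset.filter_congr fun z _ => ⟨(hf z).symm.trans, (hf z).trans⟩
  have hcard : ((Finset.Ico 0 ((p * k : ℕ) : ℤ)).filter fun z => z ≡ j [ZMOD p]).card = k := by
    have h := Int.Ico_filter_modEq_card 0 ((p * k : ℕ) : ℤ) (r := p) (by exact_mod_cast hp) j
    have hp' : (p : ℚ) ≠ 0 := by exact_mod_cast hp.ne'
    have hdiv : (((p * k : ℕ) : ℤ) - j : ℚ) / (p : ℤ) = (0 - j : ℚ) / (p : ℤ) + (k : ℤ) := by
      push_cast
      field_simp
      ring
    rw [hdiv, Int.ceil_add_intCast] at h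
    simp only [Int.cast_zero, add_sub_cancel_left] at h
    omega
  have hp' : (p : ℝ) ≠ 0 := by exact_mod_cast hp.ne'
  have hk' : (k : ℝ) ≠ 0 := by exact_mod_cast hk.ne'
  rw [uniformCharge_eq, hset, hcard, Int.card_Ico, sub_zero, Int.toNat_natCast, Nat.cast_mul]
  field_simp

lemma not_four_dvd_primorial (n : ℕ) : ¬ 4 ∣ primorial n :=
  fun h => by
    have := Nat.isUnit_iff.1 (squarefree_primorial n 2 h)
    omega

/-- Translate the multiples of four by `N`. -/
def shiftFourMultiples (N z : ℤ) : ℤ := if 4 ∣ z then z + N else z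

lemma shiftFourMultiples_modEq {N p : ℤ} (h : p ∣ N) (z : ℤ) :
    shiftFourMultiples N z ≡ z [ZMOD p] := by
  unfold shiftFourMultiples
  split_ifs
  · simpa using (Int.modEq_zero_iff_dvd.2 h).add_left z
  · rfl

lemma not_four_dvd_shiftFourMultiples {N : ℤ} (h : ¬ 4 ∣ N) (z : ℤ) :
    ¬ 4 ∣ shiftFourMultiples N z := by
  unfold shiftFourMultiples
  split_ifs <;> omega

open Filter Topology in
lemma exists_mem_PR_modEq_zero_four :
    ∃ μ ∈ PR, μ {z : ℤ | z ≡ 0 [ZMOD (4 : ℤ)]} = 0 := by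
  let ν : ℕ → Set ℤ → ℝ := fun n =>
    uniformCharge (Finset.Ico 0 (primorial n : ℤ)) (shiftFourMultiples (primorial n))
  obtain ⟨μ, hμ, hlim⟩ := exists_isProbCharge_tendsto (hyperfilter ℕ) ν fun n =>
    isProbCharge_uniformCharge
      (Finset.nonempty_Ico.2 (by exact_mod_cast primorial_pos n)) _
  refine ⟨μ, ⟨hμ, fun p hp j => ?_⟩, ?_⟩
  · refine tendsto_nhds_unique (hlim _) (tendsto_const_nhds.congr' ?_)
    refine Eventually.filter_mono (Nat.hyperfilter_le_atTop) ?_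
    filter_upwards [eventually_ge_atTop p] with n hn
    have hdvd : p ∣ primorial n := hp.dvd_primorial_iff.2 hn
    exact (uniformCharge_modEq (primorial_pos n) hp.pos hdvd
      (shiftFourMultiples_modEq (by exact_mod_cast hdvd)) j).symm
  · refine tendsto_nhds_unique (hlim _) (tendsto_const_nhds.congr fun n => ?_)
    have h4 : ¬ (4 : ℤ) ∣ primorial n := by exact_mod_cast not_four_dvd_primorial n
    simp [ν, uniformCharge, Int.modEq_zero_iff_dvd, not_four_dvd_shiftFourMultiples h4]

theorem stmt4 :
    (∃ μ ∈ PR, ∃ m : ℕ, 0 < m ∧ ∃ r : ℤ,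
      μ {z : ℤ | z ≡ r [ZMOD (m : ℤ)]} ≠ 1 / (m : ℝ)) ∧
    (∃ μ ∈ PR, μ {z : ℤ | z ≡ 0 [ZMOD (4 : ℤ)]} = 0) := by
  obtain ⟨μ, hμ, h⟩ := exists_mem_PR_modEq_zero_four
  refine ⟨⟨μ, hμ, 4, by norm_num, 0, ?_⟩, μ, hμ, h⟩
  rw [Nat.cast_ofNat, h]
  norm_num
end

section
/- Let Ω be a set, 𝒞 a collection of subsets of Ω with Ω ∈ 𝒞, and μ₀ : 𝒞 → ℝ a function. Let ℳ be the set of all probability charges μ on Ω satisfying μ(C) = μ₀(C) for every C ∈ 𝒞, and assume ℳ is nonempty. Then for every S ⊆ Ω, sSup {μ(S) : μ ∈ ℳ} = sInf {Σ_{C ∈ 𝒞} α(C)·μ₀(C) : α a finitely supported function from 𝒞 to ℚ such that for every x ∈ Ω, Σ_{C ∈ 𝒞} α(C)·1_C(x) ≥ 1_S(x)}, where 1_A denotes the indicator function of the set A. -/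
/-- A probability charge on a set `Ω`: normalized, nonnegative, finitely additive. -/
def IsProbChargeOn {Ω : Type*} (μ : Set Ω → ℝ) : Prop :=
  μ Set.univ = 1 ∧ (∀ A : Set Ω, 0 ≤ μ A) ∧
    ∀ A B : Set Ω, Disjoint A B → μ (A ∪ B) = μ A + μ B

/-- An inequality `c ≤ ∑ a i • 1_{A i}` holding on `B` may be integrated over `B` against a
probability charge. -/
theorem IsProbChargeOn.mul_le_sum_inter {Ω ι : Type*} {μ : Set Ω → ℝ} (hμ : IsProbChargeOn μ)
    (s : Finset ι) (a : ι → ℝ) (A : ι → Set Ω) (B : Set Ω) (c : ℝ)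
    (h : ∀ ω ∈ B, c ≤ ∑ i ∈ s, a i * (A i).indicator (fun _ => (1 : ℝ)) ω) :
    c * μ B ≤ ∑ i ∈ s, a i * μ (A i ∩ B) := by
  classical
  obtain ⟨-, hnonneg, hadd⟩ := hμ
  induction s using Finset.induction_on generalizing B c with
  | empty =>
    rcases B.eq_empty_or_nonempty with rfl | ⟨ω, hω⟩
    · have := hadd ∅ ∅ (Set.disjoint_empty _)
      simp only [Set.union_self] at this
      simp [show μ ∅ = 0 by linarith]
    · have hc := h ω hω
      simp only [Finset.sum_empty] at hc ⊢
      exact mul_nonpos_of_nonpos_of_nonneg hc (hnonneg B)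
  | insert j s hj ih =>
    have split (D : Set Ω) : μ D = μ (D ∩ A j) + μ (D \ A j) := by
      rw [← hadd _ _ (disjoint_sdiff_self_right.mono_left Set.inter_subset_right), Set.inter_union_sdiff]
    have inside := ih (B ∩ A j) (c - a j) fun ω hω => by
      have := h ω hω.1
      rw [Finset.sum_insert hj, Set.indicator_of_mem hω.2] at this
      linarith
    have outside := ih (B \ A j) c fun ω hω => by
      have := h ω hω.1
      rw [Finset.sum_insert hj, Set.indicator_of_notMem hω.2] at this
      linarith
    have hsum : ∑ i ∈ s, a i * μ (A i ∩ B) =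
        ∑ i ∈ s, a i * μ (A i ∩ (B ∩ A j)) + ∑ i ∈ s, a i * μ (A i ∩ (B \ A j)) := by
      rw [← Finset.sum_add_distrib]
      refine Finset.sum_congr rfl fun i _ => ?_
      rw [split (A i ∩ B), Set.inter_assoc, Set.inter_sdiff_assoc, mul_add]
    rw [Finset.sum_insert hj, hsum, split B, Set.inter_comm (A j) B]
    linarith

/-- If a simple function dominates the indicator of `S`, its integral against a probability charge
dominates the charge of `S`. -/
theorem IsProbChargeOn.le_sum_of_indicator_le {Ω ι : Type*} {μ : Set Ω → ℝ}
    (hμ : IsProbChargeOn μ) (s : Finset ι) (a : ι → ℝ) (A : ι → Set Ω) (S : Set Ω)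
    (h : ∀ ω, S.indicator (fun _ => (1 : ℝ)) ω ≤
      ∑ i ∈ s, a i * (A i).indicator (fun _ => (1 : ℝ)) ω) :
    μ S ≤ ∑ i ∈ s, a i * μ (A i) := by
  have inside := hμ.mul_le_sum_inter s a A S 1 fun ω hω => by
    simpa [Set.indicator_of_mem hω] using h ω
  have outside := hμ.mul_le_sum_inter s a A Sᶜ 0 fun ω hω => by
    simpa [Set.indicator_of_notMem hω] using h ω
  have hsum : ∑ i ∈ s, a i * μ (A i) =
      ∑ i ∈ s, a i * μ (A i ∩ S) + ∑ i ∈ s, a i * μ (A i ∩ Sᶜ) := by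
    rw [← Finset.sum_add_distrib]
    refine Finset.sum_congr rfl fun i _ => ?_
    rw [← mul_add, ← hμ.2.2 _ _ (Disjoint.mono Set.inter_subset_right Set.inter_subset_right
      disjoint_compl_right), Set.inter_union_compl]
  linarith

/-- A positive functional can be modified off a cofinal subspace `P`, keeping it positive and
unchanged on `P`, so that at a given vector it attains the upper bound forced by `P`. -/
theorem exists_nonneg_extension_isGLB {E : Type*} [AddCommGroup E] [Module ℝ E]
    (K : PointedCone ℝ E) (P : Submodule ℝ E) (φ : E →ₗ[ℝ] ℝ) (hφ : ∀ x ∈ K, 0 ≤ φ x)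
    (hP : ∀ x, ∃ p ∈ P, p - x ∈ K) {x₀ : E} (hx₀ : x₀ ≠ 0) :
    ∃ ψ : E →ₗ[ℝ] ℝ, (∀ x ∈ K, 0 ≤ ψ x) ∧ (∀ p ∈ P, ψ p = φ p) ∧
      IsGLB {r | ∃ p ∈ P, p - x₀ ∈ K ∧ φ p = r} (ψ x₀) := by
  let U (x : E) : Set ℝ := {r | ∃ p ∈ P, p - x ∈ K ∧ φ p = r}
  let N (x : E) : ℝ := sInf (U x)
  have hU (x) : IsGLB (U x) (N x) := by
    refine isGLB_csInf ?_ ⟨φ x, ?_⟩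
    · obtain ⟨p, hp, hpx⟩ := hP x
      exact ⟨φ p, p, hp, hpx, rfl⟩
    · rintro _ ⟨p, -, hpx, rfl⟩
      have := hφ _ hpx
      rw [map_sub] at this
      linarith
  have N_le {x p : E} (hp : p ∈ P) (hpx : p - x ∈ K) : N x ≤ φ p := (hU x).1 ⟨p, hp, hpx, rfl⟩
  have N_add (x y) : N (x + y) ≤ N x + N y := by
    suffices N (x + y) - N y ≤ N x by linarith
    refine (hU x).2 ?_
    rintro _ ⟨p, hp, hpx, rfl⟩
    suffices N (x + y) - φ p ≤ N y by linarith
    refine (hU y).2 ?_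
    rintro _ ⟨q, hq, hqy, rfl⟩
    have := N_le (x := x + y) (P.add_mem hp hq) (by
      rw [add_sub_add_comm]; exact K.add_mem hpx hqy)
    rw [map_add] at this
    linarith
  have N_smul_le (c : ℝ) (hc : 0 < c) (x) : N (c • x) ≤ c * N x := by
    rw [← div_le_iff₀' hc]
    refine (hU x).2 ?_
    rintro _ ⟨p, hp, hpx, rfl⟩
    rw [div_le_iff₀' hc]
    have := N_le (x := c • x) (P.smul_mem c hp) (by
      rw [← smul_sub]; exact K.smul_mem hc.le hpx)
    simpa using this
  have N_smul (c : ℝ) (hc : 0 < c) (x) : N (c • x) = c * N x := by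
    refine (N_smul_le c hc x).antisymm ?_
    have := N_smul_le c⁻¹ (inv_pos.2 hc) (c • x)
    rwa [inv_smul_smul₀ hc.ne', ← div_eq_inv_mul, le_div_iff₀' hc] at this
  have N_zero : 0 ≤ N 0 := by
    refine (hU 0).2 ?_
    rintro _ ⟨p, -, hp, rfl⟩
    exact hφ p (by simpa using hp)
  obtain ⟨ψ, hψ, hψN⟩ := exists_extension_of_le_sublinear
    (LinearPMap.mkSpanSingleton x₀ (N x₀) hx₀) N N_smul N_add (by
      rintro ⟨y, hy⟩
      obtain ⟨t, rfl⟩ := Submodule.mem_span_singleton.1 hy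
      rw [LinearPMap.mkSpanSingleton'_apply, RingHom.id_apply, smul_eq_mul]
      rcases lt_trichotomy t 0 with ht | rfl | ht
      · have h₁ := N_add (t • x₀) ((-t) • x₀)
        rw [N_smul (-t) (neg_pos.2 ht), ← add_smul, add_neg_cancel, zero_smul] at h₁
        change _ ≤ N (t • x₀)
        linarith
      · simpa using N_zero
      · exact (N_smul t ht x₀).ge)
  have hψx₀ : ψ x₀ = N x₀ := by
    have := hψ ⟨x₀, Submodule.mem_span_singleton_self x₀⟩
    rw [this]
    exact LinearPMap.mkSpanSingleton_apply ℝ ℝ hx₀ (N x₀)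
  have hψ_le {p : E} (hp : p ∈ P) : ψ p ≤ φ p :=
    (hψN p).trans (N_le hp (by simp))
  refine ⟨ψ, fun x hx => ?_, fun p hp => (hψ_le hp).antisymm ?_, hψx₀ ▸ hU x₀⟩
  · have := (hψN (-x)).trans (N_le P.zero_mem (by simpa using hx))
    simpa using this
  · simpa using hψ_le (P.neg_mem hp)

/-- The set function `A ↦ ψ (single A 1)` is a probability charge when `ψ` is positive on formal
combinations of sets and normalized. -/
theorem isProbChargeOn_of_linearMap {Ω : Type*} (ψ : (Set Ω →₀ ℝ) →ₗ[ℝ] ℝ)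
    (hψ : ∀ x, 0 ≤ Finsupp.linearCombination ℝ
      (fun A : Set Ω => A.indicator (fun _ => (1 : ℝ))) x → 0 ≤ ψ x)
    (huniv : ψ (Finsupp.single Set.univ 1) = 1) :
    IsProbChargeOn fun A => ψ (Finsupp.single A 1) := by
  refine ⟨huniv, fun A => hψ _ ?_, fun A B hAB => ?_⟩
  · rw [Finsupp.linearCombination_single, one_smul]
    exact Set.indicator_nonneg fun _ _ => zero_le_one
  · have key : Finsupp.linearCombination ℝ (fun A : Set Ω => A.indicator (fun _ => (1 : ℝ)))
        (Finsupp.single (A ∪ B) 1 - (Finsupp.single A 1 + Finsupp.single B 1)) = 0 := by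
      simp [Set.indicator_union_of_disjoint hAB, Pi.add_def]
    have h₁ := hψ _ key.ge
    have h₂ := hψ (-(Finsupp.single (A ∪ B) 1 - (Finsupp.single A 1 + Finsupp.single B 1)))
      (by rw [map_neg, key, neg_zero])
    simp only [map_neg, map_sub, map_add] at h₁ h₂
    linarith

/-- A finitely supported real function can be rounded up to a rational one, on the same support,
at arbitrarily small cost for a given weight. -/
theorem Finsupp.exists_rat_approx {ι : Type*} (β : ι →₀ ℝ) (w : ι → ℝ) (hw : ∀ i, 0 ≤ w i)
    {ε : ℝ} (hε : 0 < ε) :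
    ∃ α : ι → ℚ, (∀ i, α i ≠ 0 → i ∈ β.support) ∧ (∀ i, β i ≤ α i) ∧
      ∑ i ∈ β.support, α i * w i < ∑ i ∈ β.support, β i * w i + ε := by
  have hW : 0 ≤ ∑ i ∈ β.support, w i := Finset.sum_nonneg fun i _ => hw i
  set W := ∑ i ∈ β.support, w i with hW_def
  have hδ : 0 < ε / (W + 1) := by positivity
  choose q hq hq' using fun i => exists_rat_btwn (lt_add_of_pos_right (β i) hδ)
  classical
  refine ⟨fun i => if i ∈ β.support then q i else 0, fun i => ?_, fun i => ?_, ?_⟩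
  · simp +contextual
  · dsimp only
    split_ifs with hi
    · exact (hq i).le
    · simp [Finsupp.notMem_support_iff.1 hi]
  · calc ∑ i ∈ β.support, ((if i ∈ β.support then q i else 0 : ℚ) : ℝ) * w i
        ≤ ∑ i ∈ β.support, (β i + ε / (W + 1)) * w i := by
          refine Finset.sum_le_sum fun i hi => mul_le_mul_of_nonneg_right ?_ (hw i)
          rw [if_pos hi]
          exact (hq' i).le
      _ = ∑ i ∈ β.support, β i * w i + ε / (W + 1) * W := by
          simp only [add_mul, Finset.sum_add_distrib, ← Finset.mul_sum, hW_def]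
      _ < _ := by
          gcongr
          rw [div_mul_eq_mul_div, div_lt_iff₀ (by positivity)]
          linarith

theorem stmt6 {Ω : Type*} (𝒞 : Set (Set Ω)) (hΩ : Set.univ ∈ 𝒞) (μ₀ : 𝒞 → ℝ)
    (hne : {μ : Set Ω → ℝ | IsProbChargeOn μ ∧ ∀ C : 𝒞, μ C = μ₀ C}.Nonempty)
    (S : Set Ω) :
    sSup {x : ℝ | ∃ μ : Set Ω → ℝ,
        (IsProbChargeOn μ ∧ ∀ C : 𝒞, μ C = μ₀ C) ∧ μ S = x} =
      sInf {x : ℝ | ∃ α : 𝒞 → ℚ, {C : 𝒞 | α C ≠ 0}.Finite ∧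
        (∀ ω : Ω, S.indicator (fun _ => (1 : ℝ)) ω ≤
          ∑ᶠ C : 𝒞, (α C : ℝ) * (C : Set Ω).indicator (fun _ => (1 : ℝ)) ω) ∧
        x = ∑ᶠ C : 𝒞, (α C : ℝ) * μ₀ C} := by
  have finsum_eq {α : 𝒞 → ℚ} {s : Finset 𝒞} (hs : ∀ C, α C ≠ 0 → C ∈ s) (f : 𝒞 → ℝ) :
      ∑ᶠ C : 𝒞, (α C : ℝ) * f C = ∑ C ∈ s, (α C : ℝ) * f C := by
    refine finsum_eq_sum_of_support_subset _ fun C hC => hs C fun h => hC ?_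
    simp [h]
  set D := {x : ℝ | ∃ α : 𝒞 → ℚ, {C : 𝒞 | α C ≠ 0}.Finite ∧ _}
  have weak (μ : Set Ω → ℝ) (hμ : IsProbChargeOn μ) (hμ₀ : ∀ C : 𝒞, μ C = μ₀ C) :
      μ S ∈ lowerBounds D := by
    rintro _ ⟨α, hα, hS, rfl⟩
    have hs (C) (hC : α C ≠ 0) : C ∈ hα.toFinset := hα.mem_toFinset.2 hC
    simp only [finsum_eq hs, ← hμ₀] at hS ⊢
    exact hμ.le_sum_of_indicator_le _ _ _ S hS
  obtain ⟨μ₁, hμ₁, hμ₁₀⟩ := hne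
  let T := Finsupp.linearCombination ℝ (fun A : Set Ω => A.indicator (fun _ => (1 : ℝ)))
  let φ := Finsupp.linearCombination ℝ μ₁
  let K : PointedCone ℝ (Set Ω →₀ ℝ) := (PointedCone.positive ℝ (Ω → ℝ)).comap T
  have hT (x ω) : T x ω = ∑ A ∈ x.support, x A * A.indicator (fun _ => (1 : ℝ)) ω := by
    simp [T, Finsupp.linearCombination_apply, Finsupp.sum]
  have mem_K (x) : x ∈ K ↔ 0 ≤ T x := Iff.rfl
  let P := LinearMap.range (Finsupp.lmapDomain ℝ ℝ (Subtype.val : 𝒞 → Set Ω))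
  have single_mem (C : 𝒞) (r : ℝ) : Finsupp.single (C : Set Ω) r ∈ P :=
    ⟨Finsupp.single C r, by simp⟩
  have hφ (x) (hx : x ∈ K) : 0 ≤ φ x := by
    have := hμ₁.mul_le_sum_inter x.support x id Set.univ 0 fun ω _ => by
      exact (hT x ω).symm ▸ (mem_K x).1 hx ω
    simpa [φ, Finsupp.linearCombination_apply, Finsupp.sum] using this
  have hP (x) : ∃ p ∈ P, p - x ∈ K := by
    refine ⟨_, single_mem ⟨_, hΩ⟩ (∑ A ∈ x.support, |x A|), (mem_K _).2 fun ω => ?_⟩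
    have : ∑ A ∈ x.support, x A * A.indicator (fun _ => (1 : ℝ)) ω ≤ ∑ A ∈ x.support, |x A| := by
      refine Finset.sum_le_sum fun A _ => ?_
      by_cases hω : ω ∈ A <;> simp [hω, le_abs_self]
    rw [map_sub, Pi.sub_apply, hT x]
    simpa [T] using this
  obtain ⟨ψ, hψ, hψP, hglb⟩ := exists_nonneg_extension_isGLB K P φ hφ hP
    (x₀ := Finsupp.single S 1) (by simp)
  have hψC (C : 𝒞) : ψ (Finsupp.single (C : Set Ω) 1) = μ₁ C := by
    rw [hψP _ (single_mem C 1)]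
    simp [φ]
  have hμ := isProbChargeOn_of_linearMap ψ hψ ((hψC ⟨_, hΩ⟩).trans hμ₁.1)
  have hμ₀ (C : 𝒞) : ψ (Finsupp.single (C : Set Ω) 1) = μ₀ C := (hψC C).trans (hμ₁₀ C)
  have hDglb : IsGLB D (ψ (Finsupp.single S 1)) := by
    refine ⟨weak _ hμ hμ₀, fun b hb => hglb.2 ?_⟩
    rintro _ ⟨_, ⟨β, rfl⟩, hβ, rfl⟩
    refine le_of_forall_pos_le_add fun ε hε => ?_
    obtain ⟨α, hα, hβα, hcost⟩ := β.exists_rat_approx (fun C => μ₁ C) (fun C => hμ₁.2.1 C) hε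
    have hφβ : φ (Finsupp.lmapDomain ℝ ℝ (Subtype.val : 𝒞 → Set Ω) β) =
        ∑ C ∈ β.support, β C * μ₁ C := by
      rw [Finsupp.lmapDomain_apply, Finsupp.linearCombination_mapDomain]
      simp [Finsupp.linearCombination_apply, Finsupp.sum]
    rw [hφβ]
    refine le_trans (hb ⟨α, β.support.finite_toSet.subset hα, fun ω => ?_, rfl⟩) ?_
    · have h := (mem_K _).1 hβ ω
      rw [map_sub, Finsupp.lmapDomain_apply, Finsupp.linearCombination_mapDomain,
        Finsupp.linearCombination_single, one_smul, Pi.sub_apply, Pi.zero_apply, sub_nonneg,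
        Finsupp.linearCombination_apply, Finsupp.sum, Finset.sum_apply] at h
      rw [finsum_eq hα]
      refine h.trans (Finset.sum_le_sum fun C _ => ?_)
      exact mul_le_mul_of_nonneg_right (hβα C) (Set.indicator_nonneg (fun _ _ => zero_le_one) ω)
    · simp only [finsum_eq hα, ← hμ₁₀]
      exact hcost.le
  have hDne : D.Nonempty := by
    by_contra h
    rw [Set.not_nonempty_iff_eq_empty.1 h] at hDglb
    have : ψ (Finsupp.single S 1) + 1 ≤ ψ (Finsupp.single S 1) := hDglb.2 (by simp)
    linarith
  rw [hDglb.csInf_eq hDne]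
  refine IsGreatest.csSup_eq ⟨⟨_, ⟨hμ, hμ₀⟩, rfl⟩, ?_⟩
  rintro _ ⟨μ, ⟨hμ', hμ₀'⟩, rfl⟩
  exact hDglb.2 (weak μ hμ' hμ₀')
end

section
/- Let p_n denote the n-th prime. Let S ⊆ ℤ, and for each positive integer n let I_n be a nonempty subset of {0, 1, …, p_n − 1}. Suppose that for every positive integer N and every choice of residues j_n ∈ I_n for n = 1, …, N, there exists z ∈ S with z ≡ j_n (mod p_n) for all n ≤ N. Then sSup {μ(S) : μ ∈ PR} ≥ ⨅_{n ≥ 1} |I_n| / p_n. -/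
/-- `nthPrime n` is the `(n+1)`-st prime: `nthPrime 0 = 2`, `nthPrime 1 = 3`, … -/
noncomputable def nthPrime (n : ℕ) : ℕ := Nat.nth Nat.Prime n

open Filter Topology

lemma nthPrime_prime (n : ℕ) : (nthPrime n).Prime := Nat.prime_nth_prime n

lemma IsProbCharge.le_one {μ : Set ℤ → ℝ} (h : IsProbCharge μ) (A : Set ℤ) : μ A ≤ 1 :=
  h.1 ▸ h.mono (Set.subset_univ A)

open Classical in
/-- The empirical charge of the sample `f 0, …, f (M - 1)`. -/
noncomputable def empiricalCharge (M : ℕ) (f : ℕ → ℤ) (A : Set ℤ) : ℝ :=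
  (((Finset.range M).filter fun k => f k ∈ A).card : ℝ) / M

lemma isProbCharge_empiricalCharge {M : ℕ} (hM : 0 < M) (f : ℕ → ℤ) :
    IsProbCharge (empiricalCharge M f) := by
  classical
  have hM' : (M : ℝ) ≠ 0 := by positivity
  refine ⟨by simp [empiricalCharge, hM'], fun A => by unfold empiricalCharge; positivity,
    fun A B hAB => ?_⟩
  unfold empiricalCharge
  rw [← add_div, ← Nat.cast_add, ← Finset.card_union_of_disjoint]
  · congr 3
    ext k
    simp only [Finset.mem_filter, Finset.mem_union, Set.mem_union]
    tauto
  · rw [Finset.disjoint_filter]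
    exact fun k _ hA hB => Set.disjoint_left.1 hAB hA hB

/-- A sequence of probability charges has a pointwise limit along any ultrafilter. -/
lemma exists_tendsto_isProbCharge (U : Ultrafilter ℕ) (μ : ℕ → Set ℤ → ℝ)
    (h : ∀ N, IsProbCharge (μ N)) :
    ∃ ν, IsProbCharge ν ∧ ∀ A, Tendsto (fun N => μ N A) U (𝓝 (ν A)) := by
  have key : ∀ A, ∃ x : ℝ, Tendsto (fun N => μ N A) U (𝓝 x) := by
    intro A
    obtain ⟨x, -, hx⟩ := (isCompact_Icc (a := (0 : ℝ)) (b := 1)).ultrafilter_le_nhds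
      (U.map fun N => μ N A) (by
        rw [le_principal_iff, Ultrafilter.coe_map, mem_map]
        exact univ_mem' fun N => ⟨(h N).2.1 A, (h N).le_one A⟩)
    exact ⟨x, hx⟩
  choose ν hν using key
  refine ⟨ν, ⟨?_, fun A => ?_, fun A B hAB => ?_⟩, hν⟩
  · refine tendsto_nhds_unique (hν Set.univ) ?_
    simp only [(h _).1]
    exact tendsto_const_nhds
  · exact ge_of_tendsto' (hν A) fun N => (h N).2.1 A
  · refine tendsto_nhds_unique (hν (A ∪ B)) ?_
    simp only [(h _).2.2 A B hAB]
    exact (hν A).add (hν B)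

lemma exists_perm_mem {p : ℕ} (I : Set (Fin p)) :
    ∃ σ : Equiv.Perm (Fin p), ∀ i : Fin p, (i : ℕ) < I.ncard → σ i ∈ I := by
  classical
  have hle : I.ncard ≤ p := by simpa using Set.ncard_le_card I
  have hcard : Fintype.card {i : Fin p // (i : ℕ) < I.ncard} = Fintype.card {i // i ∈ I} := by
    rw [← Nat.card_eq_fintype_card (α := {i // i ∈ I}), Fintype.card_subtype,
      Fin.card_filter_val_lt, min_eq_right hle]
    rfl
  exact ⟨(Fintype.equivOfCardEq hcard).extendSubtype,
    fun i hi => Equiv.extendSubtype_mem _ i hi⟩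

/-- If the residues mod `p` of a sample of size `p * q` are obtained by permuting the values
`k / q`, then they are uniformly distributed. -/
lemma empiricalCharge_modEq {p q : ℕ} (hp : 0 < p) (hq : 0 < q) (σ : Equiv.Perm (Fin p))
    (f : ℕ → ℤ) (hf : ∀ k, ∀ i : Fin p, k / q = i → f k ≡ ((σ i : ℕ) : ℤ) [ZMOD (p : ℤ)])
    (j : ℤ) :
    empiricalCharge (p * q) f {z : ℤ | z ≡ j [ZMOD (p : ℤ)]} = 1 / p := by
  classical
  have hp' : (0 : ℤ) < p := by exact_mod_cast hp
  obtain ⟨r, hr⟩ : ∃ r : Fin p, j ≡ ((r : ℕ) : ℤ) [ZMOD (p : ℤ)] := by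
    have h0 := Int.emod_nonneg j hp'.ne'
    have h1 := Int.emod_lt_of_pos j hp'
    refine ⟨⟨(j % p).toNat, by omega⟩, ?_⟩
    simp only [Int.toNat_of_nonneg h0]
    exact (Int.mod_modEq j p).symm
  have hset : (Finset.range (p * q)).filter (fun k => f k ∈ {z : ℤ | z ≡ j [ZMOD (p : ℤ)]}) =
      Finset.Ico ((σ.symm r : ℕ) * q) ((σ.symm r : ℕ) * q + q) := by
    ext k
    have hdiv : k / q = (σ.symm r : ℕ) ↔ (σ.symm r : ℕ) * q ≤ k ∧ k < (σ.symm r : ℕ) * q + q := by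
      rw [Nat.div_eq_iff hq]
      omega
    rw [Finset.mem_filter, Finset.mem_Ico, Finset.mem_range, ← hdiv, Set.mem_ofPred_eq]
    constructor
    · rintro ⟨hk, hkj⟩
      have hlt : k / q < p := Nat.div_lt_of_lt_mul (by rwa [mul_comm])
      have h2 := ((hf k ⟨k / q, hlt⟩ rfl).symm.trans hkj).trans hr
      rw [Int.natCast_modEq_iff] at h2
      have h3 : σ ⟨k / q, hlt⟩ = r :=
        Fin.ext (h2.eq_of_lt_of_lt (σ ⟨k / q, hlt⟩).isLt r.isLt)
      rw [← h3, Equiv.symm_apply_apply]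
    · intro hk
      refine ⟨?_, ?_⟩
      · rw [← Nat.div_lt_iff_lt_mul hq, hk]
        exact (σ.symm r).isLt
      · have := hf k (σ.symm r) hk
        rw [Equiv.apply_symm_apply] at this
        exact this.trans hr.symm
  have hq' : (q : ℝ) ≠ 0 := by positivity
  have hp'' : (p : ℝ) ≠ 0 := by positivity
  have hcard := congrArg Finset.card hset
  rw [Nat.card_Ico, Nat.add_sub_cancel_left] at hcard
  have hval : empiricalCharge (p * q) f {z : ℤ | z ≡ j [ZMOD (p : ℤ)]} = (q : ℝ) / (p * q : ℕ) := by
    rw [← hcard]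
    unfold empiricalCharge
    congr!
  rw [hval, Nat.cast_mul]
  field_simp

lemma le_empiricalCharge {M : ℕ} (hM : 0 < M) (f : ℕ → ℤ) (S : Set ℤ) {c : ℝ} (hc : c ≤ 1)
    (hf : ∀ k : ℕ, (k : ℝ) < c * M → f k ∈ S) : c ≤ empiricalCharge M f S := by
  classical
  have hM' : (0 : ℝ) < M := by exact_mod_cast hM
  unfold empiricalCharge
  rw [le_div_iff₀ hM']
  have hsub : Finset.range ⌈c * M⌉₊ ⊆ (Finset.range M).filter fun k => f k ∈ S := by
    intro k hk
    have hk' : (k : ℝ) < c * M := Nat.lt_ceil.1 (Finset.mem_range.1 hk)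
    refine Finset.mem_filter.2 ⟨Finset.mem_range.2 ?_, hf k hk'⟩
    have : (k : ℝ) < M := by nlinarith
    exact_mod_cast this
  have hle := Finset.card_le_card hsub
  rw [Finset.card_range] at hle
  exact (Nat.le_ceil _).trans (by exact_mod_cast hle)

lemma exists_modEq_nthPrime (N : ℕ) (a : ℕ → ℕ) :
    ∃ z : ℤ, ∀ n < N, z ≡ (a n : ℤ) [ZMOD (nthPrime n : ℤ)] := by
  obtain ⟨z, hz⟩ := Nat.chineseRemainderOfFinset a nthPrime (Finset.range N)
    (fun n _ => (nthPrime_prime n).ne_zero) (fun m _ n _ hmn =>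
      (Nat.coprime_primes (nthPrime_prime m) (nthPrime_prime n)).2 fun h =>
        hmn (Nat.nth_injective Nat.infinite_setOfPred_prime h))
  exact ⟨z, fun n hn => Int.natCast_modEq_iff.2 (hz n (Finset.mem_range.2 hn))⟩

/-- A probability charge uniform modulo the first `N` primes, giving `S` mass at least `c`. -/
lemma exists_isProbCharge_uniform_lt (S : Set ℤ) (I : (n : ℕ) → Set (Fin (nthPrime n)))
    (N : ℕ)
    (hyp : ∀ j : (n : Fin N) → Fin (nthPrime n), (∀ n : Fin N, j n ∈ I n) →
      ∃ z ∈ S, ∀ n : Fin N, z ≡ ((j n : ℕ) : ℤ) [ZMOD (nthPrime n : ℤ)])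
    {c : ℝ} (hc1 : c ≤ 1) (hc : ∀ n, c ≤ ((I n).ncard : ℝ) / (nthPrime n : ℝ)) :
    ∃ μ, IsProbCharge μ ∧ c ≤ μ S ∧ ∀ n < N, ∀ j : ℤ,
      μ {z : ℤ | z ≡ j [ZMOD (nthPrime n : ℤ)]} = 1 / (nthPrime n : ℝ) := by
  choose σ hσ using fun n => exists_perm_mem (I n)
  set M := ∏ n ∈ Finset.range N, nthPrime n with hMdef
  have hM : 0 < M := Finset.prod_pos fun n _ => (nthPrime_prime n).pos
  have hdvd : ∀ n < N, nthPrime n * (M / nthPrime n) = M := fun n hn =>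
    Nat.mul_div_cancel' (Finset.dvd_prod_of_mem nthPrime (Finset.mem_range.2 hn))
  have hqpos : ∀ n < N, 0 < M / nthPrime n := fun n hn =>
    Nat.pos_of_mul_pos_left (by rw [hdvd n hn]; exact hM)
  have key : ∀ k : ℕ, ∃ z : ℤ, ((k : ℝ) < c * M → z ∈ S) ∧ ∀ n < N, ∀ i : Fin (nthPrime n),
      k / (M / nthPrime n) = i → z ≡ ((σ n i : ℕ) : ℤ) [ZMOD (nthPrime n : ℤ)] := by
    intro k
    by_cases hk : (k : ℝ) < c * M
    · have hlt : ∀ n < N, k / (M / nthPrime n) < (I n).ncard := by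
        intro n hn
        rw [Nat.div_lt_iff_lt_mul (hqpos n hn)]
        have hp : (0 : ℝ) < nthPrime n := by exact_mod_cast (nthPrime_prime n).pos
        have h1 : (M : ℝ) = nthPrime n * (M / nthPrime n : ℕ) := by exact_mod_cast (hdvd n hn).symm
        have h2 := (le_div_iff₀ hp).1 (hc n)
        have h3 : (k : ℝ) < (I n).ncard * (M / nthPrime n : ℕ) := by
          rw [h1, ← mul_assoc] at hk
          exact hk.trans_le (mul_le_mul_of_nonneg_right h2 (Nat.cast_nonneg _))
        exact_mod_cast h3
      have hle : ∀ n, (I n).ncard ≤ nthPrime n := fun n => by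
        simpa using Set.ncard_le_card (I n)
      obtain ⟨z, hzS, hz⟩ := hyp
        (fun n => σ n ⟨k / (M / nthPrime n), (hlt n n.isLt).trans_le (hle n)⟩)
        (fun n => hσ n _ (hlt n n.isLt))
      refine ⟨z, fun _ => hzS, fun n hn i hi => ?_⟩
      have h := hz ⟨n, hn⟩
      rwa [show (⟨k / (M / nthPrime n), _⟩ : Fin (nthPrime n)) = i from Fin.ext hi] at h
    · obtain ⟨z, hz⟩ := exists_modEq_nthPrime N fun n =>
        if h : k / (M / nthPrime n) < nthPrime n then (σ n ⟨_, h⟩ : ℕ) else 0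
      refine ⟨z, fun h => absurd h hk, fun n hn i hi => ?_⟩
      have h := hz n hn
      have hi' : k / (M / nthPrime n) < nthPrime n := hi ▸ i.isLt
      rw [dif_pos hi'] at h
      rwa [show (⟨k / (M / nthPrime n), hi'⟩ : Fin (nthPrime n)) = i from Fin.ext hi] at h
  choose f hfS hf using key
  refine ⟨empiricalCharge M f, isProbCharge_empiricalCharge hM f,
    le_empiricalCharge hM f S hc1 hfS, fun n hn j => ?_⟩
  have h := empiricalCharge_modEq (nthPrime_prime n).pos (hqpos n hn) (σ n) f
    (fun k => hf k n hn) j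
  rwa [hdvd n hn] at h

theorem stmt15 (S : Set ℤ) (I : (n : ℕ) → Set (Fin (nthPrime n)))
    (hne : ∀ n : ℕ, (I n).Nonempty)
    (hyp : ∀ N : ℕ, ∀ j : (n : Fin N) → Fin (nthPrime n),
      (∀ n : Fin N, j n ∈ I n) →
      ∃ z ∈ S, ∀ n : Fin N, z ≡ ((j n : ℕ) : ℤ) [ZMOD (nthPrime n : ℤ)]) :
    sSup {x : ℝ | ∃ μ ∈ PR, μ S = x} ≥
      ⨅ n : ℕ, ((I n).ncard : ℝ) / (nthPrime n : ℝ) := by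
  set c := ⨅ n : ℕ, ((I n).ncard : ℝ) / (nthPrime n : ℝ)
  have hc : ∀ n, c ≤ ((I n).ncard : ℝ) / (nthPrime n : ℝ) :=
    ciInf_le ⟨0, by rintro _ ⟨n, rfl⟩; positivity⟩
  have hc1 : c ≤ 1 := (hc 0).trans <| div_le_one_of_le₀
    (by exact_mod_cast (by simpa using Set.ncard_le_card (I 0))) (Nat.cast_nonneg _)
  choose μ hμ hμS hμp using fun N =>
    exists_isProbCharge_uniform_lt S I N (hyp N) hc1 hc
  obtain ⟨ν, hν, hlim⟩ := exists_tendsto_isProbCharge (hyperfilter ℕ) μ hμ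
  have hPR : ν ∈ PR := by
    refine ⟨hν, fun p hp j => ?_⟩
    obtain ⟨n, rfl⟩ : ∃ n, nthPrime n = p := ⟨Nat.count Nat.Prime p, Nat.nth_count hp⟩
    refine tendsto_nhds_unique (hlim _) (tendsto_const_nhds.congr' ?_)
    have hev : ∀ᶠ N in (hyperfilter ℕ : Filter ℕ), n < N :=
      Nat.hyperfilter_le_atTop (eventually_gt_atTop n)
    filter_upwards [hev] with N hN
    exact (hμp N n hN j).symm
  refine (ge_of_tendsto' (hlim S) hμS).trans (le_csSup ⟨1, ?_⟩ ⟨ν, hPR, rfl⟩)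
  rintro _ ⟨μ, hμ, rfl⟩
  exact hμ.1.le_one S
end
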